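/- For the path P_n on n ≥ 2 vertices, the lower split parameters satisfy ir_s(P_n) = γ_s(P_n) = i_s(P_n) = ⌈n/3⌉. -/

import Mathlib

open SimpleGraph

namespace SplitDomination

variable {V : Type*}

/-- `S` is an independent set of `G`. -/
def Indep (G : SimpleGraph V) (S : Set V) : Prop :=
  ∀ ⦃u⦄, u ∈ S → ∀ ⦃v⦄, v ∈ S → ¬ G.Adj u v

/-- `S` is a dominating set of `G`. -/
def Dominating (G : SimpleGraph V) (S : Set V) : Prop :=
  ∀ v ∉ S, ∃ u ∈ S, G.Adj u v

/-- The closed neighborhood `N[S]` of a set `S`. -/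
def ClosedNbhd (G : SimpleGraph V) (S : Set V) : Set V :=
  {w | w ∈ S ∨ ∃ u ∈ S, G.Adj u w}

/-- `u` has a private neighbor with respect to `S`:
a vertex `w ∈ N[u]` with `w ∉ N[S \ {u}]`. -/
def HasPrivateNbr (G : SimpleGraph V) (S : Set V) (u : V) : Prop :=
  ∃ w, (w = u ∨ G.Adj u w) ∧ w ∉ ClosedNbhd G (S \ {u})

/-- The induced subgraph `⟨T⟩` is disconnected or consists of a single vertex. -/
def DisconnOrK1 (G : SimpleGraph V) (T : Set V) : Prop :=
  ¬ (G.induce T).Connected ∨ T.ncard = 1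

/-- `G` has no isolated vertices. -/
def NoIsolated (G : SimpleGraph V) : Prop :=
  ∀ v : V, ∃ u, G.Adj u v

/-- `S` is a split dominating set: dominating, and `⟨V ∖ S⟩` is disconnected or a `K₁`. -/
def SplitDominating (G : SimpleGraph V) (S : Set V) : Prop :=
  Dominating G S ∧ DisconnOrK1 G Sᶜ

/-- `S` is a minimal split dominating set. -/
def MinimalSplitDominating (G : SimpleGraph V) (S : Set V) : Prop :=
  SplitDominating G S ∧
    ∀ u ∈ S, HasPrivateNbr G S u ∨ (G.induce (Sᶜ ∪ {u})).Connected

/-- `S` is a split independent set: independent, and `⟨V ∖ S⟩` is disconnected or a `K₁`. -/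
def SplitIndep (G : SimpleGraph V) (S : Set V) : Prop :=
  Indep G S ∧ DisconnOrK1 G Sᶜ

/-- `S` is a maximal split independent set. -/
def MaximalSplitIndep (G : SimpleGraph V) (S : Set V) : Prop :=
  SplitIndep G S ∧
    ∀ v ∉ S, ¬ Indep G (S ∪ {v}) ∨ (G.induce (S ∪ {v})ᶜ).Connected

/-- `S` is a split irredundant set: every vertex of `S` has a private neighbor
with respect to `S`, and `⟨V ∖ S⟩` is disconnected or a `K₁`. -/
def SplitIrred (G : SimpleGraph V) (S : Set V) : Prop :=
  (∀ u ∈ S, HasPrivateNbr G S u) ∧ DisconnOrK1 G Sᶜ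

/-- `S` is a maximal split irredundant set. -/
def MaximalSplitIrred (G : SimpleGraph V) (S : Set V) : Prop :=
  SplitIrred G S ∧
    ∀ v ∉ S, ¬ HasPrivateNbr G (S ∪ {v}) v ∨ (G.induce (S ∪ {v})ᶜ).Connected

/-- Split domination number `γₛ(G)`. -/
noncomputable def gammaS (G : SimpleGraph V) : ℕ :=
  sInf {n | ∃ S : Set V, SplitDominating G S ∧ S.ncard = n}

/-- Upper split domination number `Γₛ(G)`. -/
noncomputable def GammaS (G : SimpleGraph V) : ℕ :=
  sSup {n | ∃ S : Set V, MinimalSplitDominating G S ∧ S.ncard = n}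

/-- Lower split independence number `iₛ(G)`. -/
noncomputable def iS (G : SimpleGraph V) : ℕ :=
  sInf {n | ∃ S : Set V, MaximalSplitIndep G S ∧ S.ncard = n}

/-- Split independence number `βₛ(G)`. -/
noncomputable def betaS (G : SimpleGraph V) : ℕ :=
  sSup {n | ∃ S : Set V, MaximalSplitIndep G S ∧ S.ncard = n}

/-- Lower split irredundance number `irₛ(G)`. -/
noncomputable def irS (G : SimpleGraph V) : ℕ :=
  sInf {n | ∃ S : Set V, MaximalSplitIrred G S ∧ S.ncard = n}

/-- Upper split irredundance number `IRₛ(G)`. -/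
noncomputable def IRS (G : SimpleGraph V) : ℕ :=
  sSup {n | ∃ S : Set V, MaximalSplitIrred G S ∧ S.ncard = n}

/-- The vertex connectivity `k(G)`: the minimum size of a set `S`
such that `⟨V ∖ S⟩` is disconnected or a single vertex. -/
noncomputable def connK (G : SimpleGraph V) : ℕ :=
  sInf {n | ∃ S : Set V, DisconnOrK1 G Sᶜ ∧ S.ncard = n}

/-- `S` is a nonsplit dominating set: dominating and `⟨V ∖ S⟩` is connected. -/
def NonsplitDominating (G : SimpleGraph V) (S : Set V) : Prop :=
  Dominating G S ∧ (G.induce Sᶜ).Connected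

/-- `S` is a minimal nonsplit dominating set. -/
def MinimalNonsplitDominating (G : SimpleGraph V) (S : Set V) : Prop :=
  NonsplitDominating G S ∧
    ∀ u ∈ S, HasPrivateNbr G S u ∨ DisconnOrK1 G (Sᶜ ∪ {u})

/-- `S` is a nonsplit independent set: independent and `⟨V ∖ S⟩` is connected. -/
def NonsplitIndep (G : SimpleGraph V) (S : Set V) : Prop :=
  Indep G S ∧ (G.induce Sᶜ).Connected

/-- `S` is a maximal nonsplit independent set. -/
def MaximalNonsplitIndep (G : SimpleGraph V) (S : Set V) : Prop :=
  NonsplitIndep G S ∧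
    ∀ v ∉ S, ¬ Indep G (S ∪ {v}) ∨ DisconnOrK1 G (S ∪ {v})ᶜ

/-- `S` is a nonsplit irredundant set. -/
def NonsplitIrred (G : SimpleGraph V) (S : Set V) : Prop :=
  (∀ u ∈ S, HasPrivateNbr G S u) ∧ (G.induce Sᶜ).Connected

/-- `S` is a maximal nonsplit irredundant set. -/
def MaximalNonsplitIrred (G : SimpleGraph V) (S : Set V) : Prop :=
  NonsplitIrred G S ∧
    ∀ v ∉ S, ¬ HasPrivateNbr G (S ∪ {v}) v ∨ DisconnOrK1 G (S ∪ {v})ᶜ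

/-- Nonsplit domination number `γₙₛ(G)`. -/
noncomputable def gammaNS (G : SimpleGraph V) : ℕ :=
  sInf {n | ∃ S : Set V, NonsplitDominating G S ∧ S.ncard = n}

/-- Upper nonsplit domination number `Γₙₛ(G)`. -/
noncomputable def GammaNS (G : SimpleGraph V) : ℕ :=
  sSup {n | ∃ S : Set V, MinimalNonsplitDominating G S ∧ S.ncard = n}

/-- Lower nonsplit independence number `iₙₛ(G)`. -/
noncomputable def iNS (G : SimpleGraph V) : ℕ :=
  sInf {n | ∃ S : Set V, MaximalNonsplitIndep G S ∧ S.ncard = n}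

/-- Nonsplit independence number `βₙₛ(G)`. -/
noncomputable def betaNS (G : SimpleGraph V) : ℕ :=
  sSup {n | ∃ S : Set V, MaximalNonsplitIndep G S ∧ S.ncard = n}

/-- Lower nonsplit irredundance number `irₙₛ(G)`. -/
noncomputable def irNS (G : SimpleGraph V) : ℕ :=
  sInf {n | ∃ S : Set V, MaximalNonsplitIrred G S ∧ S.ncard = n}

/-- `G` is a 2-tree: it can be built from `K₃` by repeatedly adding a new vertex
adjacent to exactly the two endpoints of an existing edge.  This is expressed via a
construction ordering of the vertices. -/
def IsTwoTree [Fintype V] (G : SimpleGraph V) : Prop :=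
  ∃ (n : ℕ) (_ : 3 ≤ n) (e : V ≃ Fin n),
    (∀ i j : Fin n, i ≠ j → i.val < 3 → j.val < 3 → G.Adj (e.symm i) (e.symm j)) ∧
    (∀ i : Fin n, 3 ≤ i.val → ∃ j k : Fin n, j < i ∧ k < i ∧ j ≠ k ∧
      G.Adj (e.symm j) (e.symm k) ∧
      (∀ l : Fin n, l < i → (G.Adj (e.symm l) (e.symm i) ↔ l = j ∨ l = k)))

theorem connected_induce_compl_of_insert {G : SimpleGraph V} {S : Set V} {u v : V}
    (hu : u ∉ S) (hv : v ∉ S) (huv : G.Adj u v)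
    (h : (G.induce (S ∪ {v})ᶜ).Connected) : (G.induce Sᶜ).Connected := by
  rw [connected_iff_exists_forall_reachable]
  refine ⟨⟨u, hu⟩, ?_⟩
  rintro ⟨w, hw⟩
  by_cases hwv : w = v
  · subst hwv
    exact Adj.reachable (G := G.induce Sᶜ) huv
  · have hle : (S ∪ {v})ᶜ ⊆ Sᶜ := Set.compl_subset_compl.2 Set.subset_union_left
    have hu' : u ∈ (S ∪ {v})ᶜ := by simp [hu, huv.ne]
    have hw' : w ∈ (S ∪ {v})ᶜ := by
      rintro (h | h)
      exacts [hw h, hwv h]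
    exact (h.preconnected ⟨u, hu'⟩ ⟨w, hw'⟩).map (induceHomOfLE G hle).toHom

/-- Adding a vertex that `S` does not dominate cannot make the complement connected. -/
theorem dominating_of_forall_connected {G : SimpleGraph V} {S : Set V} (hG : NoIsolated G)
    (hS : DisconnOrK1 G Sᶜ)
    (h : ∀ v ∉ S, (∀ u ∈ S, ¬ G.Adj u v) → (G.induce (S ∪ {v})ᶜ).Connected) :
    Dominating G S := by
  intro v hv
  by_contra! hdom
  obtain ⟨u, huv⟩ := hG v
  have hu : u ∉ S := fun hu => hdom u hu huv
  rcases hS with hS | hS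
  · exact hS (connected_induce_compl_of_insert hu hv huv (h v hv hdom))
  · obtain ⟨a, ha⟩ := Set.ncard_eq_one.1 hS
    have hua : u ∈ ({a} : Set V) := ha ▸ hu
    have hva : v ∈ ({a} : Set V) := ha ▸ hv
    exact huv.ne (hua.trans hva.symm)

theorem MaximalSplitIndep.dominating {G : SimpleGraph V} {S : Set V} (hG : NoIsolated G)
    (hS : MaximalSplitIndep G S) : Dominating G S := by
  refine dominating_of_forall_connected hG hS.1.2 fun v hv hdom =>
    (hS.2 v hv).resolve_left (not_not_intro ?_)
  rintro a (ha | rfl) b (hb | rfl)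
  · exact hS.1.1 ha hb
  · exact hdom a ha
  · exact fun hab => hdom b hb hab.symm
  · exact G.irrefl

theorem MaximalSplitIrred.dominating {G : SimpleGraph V} {S : Set V} (hG : NoIsolated G)
    (hS : MaximalSplitIrred G S) : Dominating G S := by
  refine dominating_of_forall_connected hG hS.1.2 fun v hv hdom =>
    (hS.2 v hv).resolve_left (not_not_intro ⟨v, Or.inl rfl, ?_⟩)
  rintro (⟨-, hne⟩ | ⟨u, ⟨hu | hu, hne⟩, huv⟩)
  · exact hne rfl
  · exact hdom u hu huv
  · exact hne hu

theorem maximalSplitIndep_of_dominating {G : SimpleGraph V} {S : Set V} (hI : Indep G S)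
    (hD : Dominating G S) (hS : DisconnOrK1 G Sᶜ) : MaximalSplitIndep G S := by
  refine ⟨⟨hI, hS⟩, fun v hv => Or.inl fun h => ?_⟩
  obtain ⟨u, hu, huv⟩ := hD v hv
  exact h (Or.inl hu) (Or.inr rfl) huv

theorem maximalSplitIrred_of_dominating {G : SimpleGraph V} {S : Set V} (hI : Indep G S)
    (hD : Dominating G S) (hS : DisconnOrK1 G Sᶜ) : MaximalSplitIrred G S := by
  refine ⟨⟨fun u hu => ⟨u, Or.inl rfl, ?_⟩, hS⟩, fun v hv => Or.inl ?_⟩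
  · rintro (⟨-, hne⟩ | ⟨w, ⟨hw, -⟩, hwu⟩)
    · exact hne rfl
    · exact hI hw hu hwu
  · rintro ⟨w, -, hw⟩
    have hsub : S ⊆ (S ∪ {v}) \ {v} := fun x hx => ⟨Or.inl hx, fun hxv => hv (hxv ▸ hx)⟩
    by_cases hwS : w ∈ S
    · exact hw (Or.inl (hsub hwS))
    · obtain ⟨u, hu, huw⟩ := hD w hwS
      exact hw (Or.inr ⟨u, hsub hu, huw⟩)

theorem noIsolated_pathGraph {n : ℕ} (hn : 2 ≤ n) : NoIsolated (pathGraph n) := by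
  intro v
  by_cases hv : v.val = 0
  · exact ⟨⟨1, by omega⟩, by rw [pathGraph_adj]; right; simp [hv]⟩
  · exact ⟨⟨v.val - 1, by omega⟩, by rw [pathGraph_adj]; left; simp only; omega⟩

theorem le_ncard_of_dominating_pathGraph {n : ℕ} {S : Set (Fin n)}
    (hS : Dominating (pathGraph n) S) : (n + 2) / 3 ≤ S.ncard := by
  classical
  have hsub : Finset.range n ⊆
      S.toFinset.biUnion fun u => ({u.val - 1, u.val, u.val + 1} : Finset ℕ) := by
    intro i hi
    simp only [Finset.mem_biUnion, Set.mem_toFinset, Finset.mem_insert, Finset.mem_singleton]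
    by_cases hiS : (⟨i, Finset.mem_range.1 hi⟩ : Fin n) ∈ S
    · exact ⟨_, hiS, by simp⟩
    · obtain ⟨u, hu, hui⟩ := hS _ hiS
      rw [pathGraph_adj] at hui
      exact ⟨u, hu, by simp only at hui; omega⟩
  have hcard := (Finset.card_le_card hsub).trans
    (Finset.card_biUnion_le_card_mul _ _ 3 fun _ _ => Finset.card_le_three)
  rw [Finset.card_range, ← Set.ncard_eq_toFinset_card'] at hcard
  omega

/-- Every third vertex of the path, starting from the second one, together with the last vertex
if that one is not yet dominated. -/
def pathLowerSet (n : ℕ) : Set (Fin n) :=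
  {i | i.val % 3 = 1 ∨ (n % 3 = 1 ∧ i.val + 1 = n)}

theorem indep_pathLowerSet (n : ℕ) : Indep (pathGraph n) (pathLowerSet n) := by
  intro u hu v hv huv
  rw [pathGraph_adj] at huv
  simp only [pathLowerSet, Set.mem_ofPred_eq] at hu hv
  omega

theorem dominating_pathLowerSet (n : ℕ) : Dominating (pathGraph n) (pathLowerSet n) := by
  intro v hv
  simp only [pathLowerSet, Set.mem_ofPred_eq] at hv ⊢
  have hvn := v.isLt
  by_cases h : v.val % 3 = 0
  · exact ⟨⟨v.val + 1, by omega⟩, by simp only; omega, by rw [pathGraph_adj]; simp⟩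
  · exact ⟨⟨v.val - 1, by omega⟩, by simp only; omega, by rw [pathGraph_adj]; simp only; omega⟩

theorem disconnOrK1_compl_pathLowerSet {n : ℕ} (hn : 2 ≤ n) :
    DisconnOrK1 (pathGraph n) (pathLowerSet n)ᶜ := by
  obtain rfl | hn := hn.eq_or_lt
  · refine Or.inr (Set.ncard_eq_one.2 ⟨0, ?_⟩)
    ext i
    fin_cases i <;> simp [pathLowerSet]
  · refine Or.inl fun h => ?_
    have h0 : (⟨0, by omega⟩ : Fin n) ∈ (pathLowerSet n)ᶜ := by
      simp only [pathLowerSet, Set.mem_compl_iff, Set.mem_ofPred_eq]; omega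
    have h2 : (⟨2, by omega⟩ : Fin n) ∈ (pathLowerSet n)ᶜ := by
      simp only [pathLowerSet, Set.mem_compl_iff, Set.mem_ofPred_eq]; omega
    obtain ⟨p⟩ := h.preconnected ⟨_, h0⟩ ⟨_, h2⟩
    cases p with
    | @cons _ v _ hadj _ =>
      have hv := v.2
      rw [induce_adj, pathGraph_adj] at hadj
      simp only [pathLowerSet, Set.mem_compl_iff, Set.mem_ofPred_eq] at hv hadj
      omega

theorem ncard_pathLowerSet (n : ℕ) : (pathLowerSet n).ncard = (n + 2) / 3 := by
  refine le_antisymm ?_ (le_ncard_of_dominating_pathGraph (dominating_pathLowerSet n))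
  have hcard := Set.ncard_le_ncard_of_injOn (s := pathLowerSet n)
    (t := (Finset.range ((n + 2) / 3) : Set ℕ)) (fun i => i.val / 3)
    (fun i _ => by
      have := i.isLt
      simp only [Finset.coe_range, Set.mem_Iio]
      omega)
    (fun i hi j hj hij => by
      simp only [pathLowerSet, Set.mem_ofPred_eq] at hi hj hij
      ext
      omega)
  rwa [Set.ncard_coe_finset, Finset.card_range] at hcard

/-- For the path `Pₙ`, `n ≥ 2`:
`irₛ = γₛ = iₛ = ⌈n/3⌉`.  (Note `⌈n/3⌉ = (n + 2) / 3` in `ℕ`.) -/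
theorem path_lower_split_params (n : ℕ) (hn : 2 ≤ n) :
    irS (SimpleGraph.pathGraph n) = (n + 2) / 3 ∧
    gammaS (SimpleGraph.pathGraph n) = (n + 2) / 3 ∧
    iS (SimpleGraph.pathGraph n) = (n + 2) / 3 := by
  have hG := noIsolated_pathGraph hn
  have hI := indep_pathLowerSet n
  have hD := dominating_pathLowerSet n
  have hS := disconnOrK1_compl_pathLowerSet hn
  have hcard := ncard_pathLowerSet n
  refine ⟨IsLeast.csInf_eq ⟨⟨_, maximalSplitIrred_of_dominating hI hD hS, hcard⟩, ?_⟩,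
    IsLeast.csInf_eq ⟨⟨_, ⟨hD, hS⟩, hcard⟩, ?_⟩,
    IsLeast.csInf_eq ⟨⟨_, maximalSplitIndep_of_dominating hI hD hS, hcard⟩, ?_⟩⟩
  · rintro _ ⟨S, h, rfl⟩
    exact le_ncard_of_dominating_pathGraph (h.dominating hG)
  · rintro _ ⟨S, h, rfl⟩
    exact le_ncard_of_dominating_pathGraph h.1
  · rintro _ ⟨S, h, rfl⟩
    exact le_ncard_of_dominating_pathGraph (h.dominating hG)

end SplitDomination
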